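/- arXiv:2109.01575 — 9 statements merged into one kernel-verified Lean document; each statement's English description precedes it below -/
import Mathlib

section
/- The success region of a Sequence composition equals the intersection of the success regions of its children: {x ∈ ℝⁿ | x ∈ S (e x)} = ⋂_{j} S j, where e x is the executed-child index of the Sequence at x. -/
/-- The success region of a Sequence composition equals the
intersection of the success regions of its children. -/
theorem sequence_success_region (n M : ℕ) (hM : 1 ≤ M)
    (R S F : Fin M → Set (Fin n → ℝ))
    (hRS : ∀ j, Disjoint (R j) (S j))
    (hRF : ∀ j, Disjoint (R j) (F j))
    (hSF : ∀ j, Disjoint (S j) (F j))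
    (hcover : ∀ j, R j ∪ S j ∪ F j = Set.univ)
    (e : (Fin n → ℝ) → Fin M)
    (he : ∀ x, ((e x).val = M - 1 ∨ x ∉ S (e x)) ∧
      ∀ j : Fin M, j < e x → ¬(j.val = M - 1 ∨ x ∉ S j)) :
    {x | x ∈ S (e x)} = ⋂ j, S j := by
  ext x
  simp only [Set.mem_setOf_eq, Set.mem_iInter]
  refine ⟨fun hx j => ?_, fun h => h _⟩
  obtain ⟨h1, h2⟩ := he x
  have hl : (e x).val = M - 1 := h1.resolve_right (fun h => h hx)
  rcases lt_or_ge j (e x) with hj | hj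
  · by_contra hn
    exact h2 j hj (Or.inr hn)
  · have hje : j = e x := by
      apply Fin.ext
      have h3 : (e x).val ≤ j.val := hj
      have h4 := j.isLt
      omega
    rw [hje]
    exact hx
end

section
/- The running region of a Sequence composition equals the union over children j of the child's running region intersected with the success regions of all earlier children: {x ∈ ℝⁿ | x ∈ R (e x)} = ⋃_{j} (R j ∩ ⋂_{k < j} S k), where e x is the executed-child index of the Sequence at x. -/
/-- The running region of a Sequence composition equals the union
over children `j` of the child's running region intersected with the success
regions of all earlier children. -/
theorem sequence_running_region (n M : ℕ) (hM : 1 ≤ M)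
    (R S F : Fin M → Set (Fin n → ℝ))
    (hRS : ∀ j, Disjoint (R j) (S j))
    (hRF : ∀ j, Disjoint (R j) (F j))
    (hSF : ∀ j, Disjoint (S j) (F j))
    (hcover : ∀ j, R j ∪ S j ∪ F j = Set.univ)
    (e : (Fin n → ℝ) → Fin M)
    (he : ∀ x, ((e x).val = M - 1 ∨ x ∉ S (e x)) ∧
      ∀ j : Fin M, j < e x → ¬(j.val = M - 1 ∨ x ∉ S j)) :
    {x | x ∈ R (e x)} = ⋃ j, (R j ∩ ⋂ k < j, S k) := by
  ext x
  obtain ⟨h1, h2⟩ := he x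
  simp only [Set.mem_setOf_eq, Set.mem_iUnion, Set.mem_inter_iff, Set.mem_iInter]
  constructor
  · intro h
    exact ⟨e x, h, fun k hk => by
      by_contra hc
      exact h2 k hk (Or.inr hc)⟩
  · rintro ⟨j, hj, hk⟩
    have hjS : x ∉ S j := fun hs => Set.disjoint_left.mp (hRS j) hj hs
    rcases lt_trichotomy j (e x) with h | h | h
    · exact absurd (Or.inr hjS) (h2 j h)
    · rw [← h]
      exact hj
    · rcases h1 with h1 | h1
      · have := j.isLt
        have h' : (e x).val < j.val := h
        omega
      · exact absurd (hk _ h) h1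
end

section
/- The failure region of a Sequence composition equals the union over children j of the child's failure region intersected with the success regions of all earlier children: {x ∈ ℝⁿ | x ∈ F (e x)} = ⋃_{j} (F j ∩ ⋂_{k < j} S k), where e x is the executed-child index of the Sequence at x. -/
/-- The failure region of a Sequence composition equals the union
over children `j` of the child's failure region intersected with the success
regions of all earlier children. -/
theorem sequence_failure_region (n M : ℕ) (hM : 1 ≤ M)
    (R S F : Fin M → Set (Fin n → ℝ))
    (hRS : ∀ j, Disjoint (R j) (S j))
    (hRF : ∀ j, Disjoint (R j) (F j))
    (hSF : ∀ j, Disjoint (S j) (F j))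
    (hcover : ∀ j, R j ∪ S j ∪ F j = Set.univ)
    (e : (Fin n → ℝ) → Fin M)
    (he : ∀ x, ((e x).val = M - 1 ∨ x ∉ S (e x)) ∧
      ∀ j : Fin M, j < e x → ¬(j.val = M - 1 ∨ x ∉ S j)) :
    {x | x ∈ F (e x)} = ⋃ j, (F j ∩ ⋂ k < j, S k) := by
  ext x
  simp only [Set.mem_setOf_eq, Set.mem_iUnion, Set.mem_inter_iff, Set.mem_iInter]
  obtain ⟨h1, h2⟩ := he x
  constructor
  · intro hx
    refine ⟨e x, hx, fun k hk => ?_⟩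
    by_contra hc
    exact h2 k hk (Or.inr hc)
  · rintro ⟨j, hj, hk⟩
    have hjS : x ∉ S j := fun h => Set.disjoint_left.mp (hSF j) h hj
    rcases lt_trichotomy j (e x) with h | h | h
    · exact absurd (Or.inr hjS) (h2 j h)
    · rwa [← h]
    · rcases h1 with h1 | h1
      · have := j.isLt
        have h' : (e x).val < j.val := h
        omega
      · exact absurd (hk _ h) h1
end

section
/- The running region of a Fallback composition equals the union over children j of the child's running region intersected with the failure regions of all earlier children: {x ∈ ℝⁿ | x ∈ R (e' x)} = ⋃_{j} (R j ∩ ⋂_{k < j} F k), where e' x is the executed-child index of the Fallback at x. -/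
/-- The running region of a Fallback composition equals the union
over children `j` of the child's running region intersected with the failure
regions of all earlier children. -/
theorem fallback_running_region (n M : ℕ) (hM : 1 ≤ M)
    (R S F : Fin M → Set (Fin n → ℝ))
    (hRS : ∀ j, Disjoint (R j) (S j))
    (hRF : ∀ j, Disjoint (R j) (F j))
    (hSF : ∀ j, Disjoint (S j) (F j))
    (hcover : ∀ j, R j ∪ S j ∪ F j = Set.univ)
    (e' : (Fin n → ℝ) → Fin M)
    (he' : ∀ x, ((e' x).val = M - 1 ∨ x ∉ F (e' x)) ∧
      ∀ j : Fin M, j < e' x → ¬(j.val = M - 1 ∨ x ∉ F j)) :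
    {x | x ∈ R (e' x)} = ⋃ j, (R j ∩ ⋂ k < j, F k) := by
  ext x
  obtain ⟨h1, h2⟩ := he' x
  simp only [Set.mem_setOf_eq, Set.mem_iUnion, Set.mem_inter_iff, Set.mem_iInter]
  constructor
  · intro hx
    refine ⟨e' x, hx, fun k hk => ?_⟩
    by_contra hc
    exact h2 k hk (Or.inr hc)
  · rintro ⟨j, hj, hk⟩
    have hjF : x ∉ F j := fun h => Set.disjoint_left.mp (hRF j) hj h
    rcases lt_trichotomy j (e' x) with h | h | h
    · exact absurd (Or.inr hjF) (h2 j h)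
    · rw [← h]
      exact hj
    · rcases h1 with h1 | h1
      · have := j.isLt
        have h3 : (e' x).val < j.val := h
        omega
      · exact absurd (hk _ h) h1
end

section
/- The success region of a Fallback composition equals the union over children j of the child's success region intersected with the failure regions of all earlier children: {x ∈ ℝⁿ | x ∈ S (e' x)} = ⋃_{j} (S j ∩ ⋂_{k < j} F k), where e' x is the executed-child index of the Fallback at x. -/
/-- The success region of a Fallback composition equals the union
over children `j` of the child's success region intersected with the failure
regions of all earlier children. -/
theorem fallback_success_region (n M : ℕ) (hM : 1 ≤ M)
    (R S F : Fin M → Set (Fin n → ℝ))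
    (hRS : ∀ j, Disjoint (R j) (S j))
    (hRF : ∀ j, Disjoint (R j) (F j))
    (hSF : ∀ j, Disjoint (S j) (F j))
    (hcover : ∀ j, R j ∪ S j ∪ F j = Set.univ)
    (e' : (Fin n → ℝ) → Fin M)
    (he' : ∀ x, ((e' x).val = M - 1 ∨ x ∉ F (e' x)) ∧
      ∀ j : Fin M, j < e' x → ¬(j.val = M - 1 ∨ x ∉ F j)) :
    {x | x ∈ S (e' x)} = ⋃ j, (S j ∩ ⋂ k < j, F k) := by
  ext x
  simp only [Set.mem_setOf_eq, Set.mem_iUnion, Set.mem_inter_iff, Set.mem_iInter]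
  obtain ⟨h1, h2⟩ := he' x
  constructor
  · intro hx
    refine ⟨e' x, hx, fun k hk => ?_⟩
    by_contra hn
    exact h2 k hk (Or.inr hn)
  · rintro ⟨j, hj, hk⟩
    have hjF : x ∉ F j := fun h => Set.disjoint_left.mp (hSF j) hj h
    rcases lt_trichotomy j (e' x) with h | h | h
    · exact absurd (Or.inr hjF) (h2 j h)
    · exact h ▸ hj
    · rcases h1 with h1 | h1
      · have := j.isLt
        have h' : (e' x).val < j.val := h
        omega
      · exact absurd (hk _ h) h1
end

section
/- The failure region of a Fallback composition equals the intersection of the failure regions of its children: {x ∈ ℝⁿ | x ∈ F (e' x)} = ⋂_{j} F j, where e' x is the executed-child index of the Fallback at x. -/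
/-- The failure region of a Fallback composition equals the
intersection of the failure regions of its children. -/
theorem fallback_failure_region (n M : ℕ) (hM : 1 ≤ M)
    (R S F : Fin M → Set (Fin n → ℝ))
    (hRS : ∀ j, Disjoint (R j) (S j))
    (hRF : ∀ j, Disjoint (R j) (F j))
    (hSF : ∀ j, Disjoint (S j) (F j))
    (hcover : ∀ j, R j ∪ S j ∪ F j = Set.univ)
    (e' : (Fin n → ℝ) → Fin M)
    (he' : ∀ x, ((e' x).val = M - 1 ∨ x ∉ F (e' x)) ∧
      ∀ j : Fin M, j < e' x → ¬(j.val = M - 1 ∨ x ∉ F j)) :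
    {x | x ∈ F (e' x)} = ⋂ j, F j := by
  ext x
  simp only [Set.mem_setOf_eq, Set.mem_iInter]
  constructor
  · intro hx j
    obtain ⟨h1, h2⟩ := he' x
    have hl : (e' x).val = M - 1 := h1.resolve_right (fun h => h hx)
    rcases lt_or_ge j (e' x) with hj | hj
    · by_contra hc
      exact h2 j hj (Or.inr hc)
    · have hje : j = e' x := by
        apply Fin.ext
        have h3 : (e' x).val ≤ j.val := hj
        have h4 := j.isLt
        omega
      rw [hje]
      exact hx
  · intro h
    exact h (e' x)
end

section
/- For a behavior tree whose root is a single Sequence over M leaf controllers, the operating regions Ω j := (⋂_{k < j} S k) ∩ (R j ∪ F j) for j < M−1 and Ω_{M−1} := ⋂_{k < M−1} S k are pairwise disjoint, their union is all of ℝⁿ, and for every x ∈ Ω j the executed-child index satisfies e x = j (hence the root's control u₀ x := u (e x) x equals u j x on Ω j). -/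
/-- Operating regions of a root Sequence over `M` leaf
controllers: `Ω j = (⋂ k < j, S k) ∩ (R j ∪ F j)` for non-last `j` and
`Ω (M-1) = ⋂ k < M-1, S k`; these are pairwise disjoint, cover `ℝⁿ`, and on
`Ω j` the executed child is `j`, so the root control equals `u j`. -/
theorem sequence_root_operating_regions (n m M : ℕ) (hM : 1 ≤ M)
    (R S F : Fin M → Set (Fin n → ℝ))
    (hRS : ∀ j, Disjoint (R j) (S j))
    (hRF : ∀ j, Disjoint (R j) (F j))
    (hSF : ∀ j, Disjoint (S j) (F j))
    (hcover : ∀ j, R j ∪ S j ∪ F j = Set.univ)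
    (u : Fin M → (Fin n → ℝ) → (Fin m → ℝ))
    (e : (Fin n → ℝ) → Fin M)
    (he : ∀ x, ((e x).val = M - 1 ∨ x ∉ S (e x)) ∧
      ∀ j : Fin M, j < e x → ¬(j.val = M - 1 ∨ x ∉ S j))
    (Ω : Fin M → Set (Fin n → ℝ))
    (hΩ : ∀ j : Fin M,
      Ω j = if j.val = M - 1 then ⋂ k < j, S k
            else (⋂ k < j, S k) ∩ (R j ∪ F j)) :
    (∀ j k : Fin M, j ≠ k → Disjoint (Ω j) (Ω k)) ∧
    (⋃ j, Ω j) = Set.univ ∧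
    (∀ j : Fin M, ∀ x ∈ Ω j, e x = j ∧ u (e x) x = u j x) := by
  have hns : ∀ j x, x ∈ R j ∪ F j ↔ x ∉ S j := by
    intro j x
    have h1 : x ∈ R j ∪ S j ∪ F j := by rw [hcover j]; trivial
    constructor
    · rintro (h | h) hs
      · exact Set.disjoint_left.mp (hRS j) h hs
      · exact Set.disjoint_left.mp (hSF j) hs h
    · intro hs
      rcases h1 with (h | h) | h
      · exact Or.inl h
      · exact absurd h hs
      · exact Or.inr h
  have hmem : ∀ j x, x ∈ Ω j ↔ (∀ k < j, x ∈ S k) ∧ (j.val = M - 1 ∨ x ∉ S j) := by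
    intro j x
    rw [hΩ j]
    split_ifs with h
    · simp [h]
    · rw [Set.mem_inter_iff, hns]
      simp [h]
  have key : ∀ j x, x ∈ Ω j ↔ e x = j := by
    intro j x
    rw [hmem]
    obtain ⟨h1, h2⟩ := he x
    constructor
    · rintro ⟨h3, h4⟩
      rcases lt_trichotomy (e x) j with h | h | h
      · rcases h1 with h1 | h1
        · have := j.isLt
          have : (e x).val < j.val := h
          omega
        · exact absurd (h3 _ h) h1
      · exact h
      · exact absurd h4 (h2 j h)
    · rintro rfl
      exact ⟨fun k hk => by_contra fun hn => h2 k hk (Or.inr hn), h1⟩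
  refine ⟨?_, ?_, ?_⟩
  · intro j k hjk
    rw [Set.disjoint_left]
    intro x hj hk
    exact hjk (((key j x).mp hj).symm.trans ((key k x).mp hk))
  · exact Set.eq_univ_of_forall fun x => Set.mem_iUnion.mpr ⟨e x, (key _ x).mpr rfl⟩
  · intro j x hx
    have h := (key j x).mp hx
    exact ⟨h, by rw [h]⟩
end

section
/- For a behavior tree whose root is a single Fallback over M leaf controllers, the operating regions Ω j := (⋂_{k < j} F k) ∩ (R j ∪ S j) for j < M−1 and Ω_{M−1} := ⋂_{k < M−1} F k are pairwise disjoint, their union is all of ℝⁿ, and for every x ∈ Ω j the executed-child index satisfies e' x = j (hence the root's control u₀ x := u (e' x) x equals u j x on Ω j). -/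
/-- Operating regions of a root Fallback over `M` leaf
controllers: `Ω j = (⋂ k < j, F k) ∩ (R j ∪ S j)` for non-last `j` and
`Ω (M-1) = ⋂ k < M-1, F k`; these are pairwise disjoint, cover `ℝⁿ`, and on
`Ω j` the executed child is `j`, so the root control equals `u j`. -/
theorem fallback_root_operating_regions (n m M : ℕ) (hM : 1 ≤ M)
    (R S F : Fin M → Set (Fin n → ℝ))
    (hRS : ∀ j, Disjoint (R j) (S j))
    (hRF : ∀ j, Disjoint (R j) (F j))
    (hSF : ∀ j, Disjoint (S j) (F j))
    (hcover : ∀ j, R j ∪ S j ∪ F j = Set.univ)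
    (u : Fin M → (Fin n → ℝ) → (Fin m → ℝ))
    (e' : (Fin n → ℝ) → Fin M)
    (he' : ∀ x, ((e' x).val = M - 1 ∨ x ∉ F (e' x)) ∧
      ∀ j : Fin M, j < e' x → ¬(j.val = M - 1 ∨ x ∉ F j))
    (Ω : Fin M → Set (Fin n → ℝ))
    (hΩ : ∀ j : Fin M,
      Ω j = if j.val = M - 1 then ⋂ k < j, F k
            else (⋂ k < j, F k) ∩ (R j ∪ S j)) :
    (∀ j k : Fin M, j ≠ k → Disjoint (Ω j) (Ω k)) ∧
    (⋃ j, Ω j) = Set.univ ∧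
    (∀ j : Fin M, ∀ x ∈ Ω j, e' x = j ∧ u (e' x) x = u j x) := by
  have hRS' : ∀ (j : Fin M) x, x ∈ R j ∪ S j ↔ x ∉ F j := by
    intro j x
    constructor
    · rintro (h | h) hF
      · exact Set.disjoint_left.mp (hRF j) h hF
      · exact Set.disjoint_left.mp (hSF j) h hF
    · intro hF
      have h : x ∈ R j ∪ S j ∪ F j := by rw [hcover j]; trivial
      exact h.resolve_right hF
  have hmem : ∀ (j : Fin M) x, x ∈ Ω j ↔
      (∀ k < j, x ∈ F k) ∧ (j.val = M - 1 ∨ x ∉ F j) := by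
    intro j x
    rw [hΩ j]
    split_ifs with h
    · simp [h]
    · rw [Set.mem_inter_iff, hRS']
      simp [h]
  have key : ∀ j : Fin M, ∀ x ∈ Ω j, e' x = j := by
    intro j x hx
    obtain ⟨h1, h2⟩ := (hmem j x).mp hx
    obtain ⟨h3, h4⟩ := he' x
    rcases lt_trichotomy (e' x) j with h | h | h
    · rcases h3 with h3 | h3
      · have := j.isLt
        have h' : (e' x).val < j.val := h
        omega
      · exact absurd (h1 _ h) h3
    · exact h
    · exact absurd h2 (h4 j h)
  refine ⟨?_, ?_, ?_⟩
  · intro j k hjk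
    rw [Set.disjoint_left]
    intro x hj hk
    exact hjk ((key j x hj).symm.trans (key k x hk))
  · rw [Set.eq_univ_iff_forall]
    intro x
    rw [Set.mem_iUnion]
    refine ⟨e' x, (hmem _ x).mpr ⟨?_, (he' x).1⟩⟩
    intro k hk
    by_contra hF
    exact (he' x).2 k hk (Or.inr hF)
  · intro j x hx
    have h := key j x hx
    exact ⟨h, by rw [h]⟩
end

section
/- Convergence of behavior tree execution: suppose (invariance) for every i ∈ L and all times 0 ≤ s ≤ t, x s ∈ Λ i implies x t ∈ Λ i, and (finite-time escape) for every i ∈ L and every t ≥ 0, x t ∈ Ω i \ S₀ implies x (t + τ i) ∉ Ω i \ S₀. Then for every i₀ ∈ L with x 0 ∈ Λ i₀, there exist a finite strictly increasing chain i₀ = j₀ < j₁ < ⋯ < j_r in L and a time t with 0 ≤ t ≤ τ j₀ + τ j₁ + ⋯ + τ j_r such that x t ∈ S₀; in particular x reaches S₀ within time ∑_{j ∈ L, j ≥ i₀} τ j and after at most card L transitions. -/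
open Classical

/-- Convergence of behavior tree execution. Under invariance of
the constraint regions `Λ i = (⋃ j ≥ i, Ω j) \ F₀` and finite-time escape from
each `Ω i \ S₀` within time `τ i`, any trajectory starting in `Λ i₀` reaches
the success region `S₀` along a strictly increasing chain starting at `i₀`,
within time bounded by the sum of the `τ` over that chain (hence within time
`∑_{j ≥ i₀} τ j` and at most `card L` transitions). -/
theorem bt_convergence (n : ℕ) (L : Type) [Fintype L] [PartialOrder L]
    (Ω : L → Set (Fin n → ℝ))
    (hdisj : ∀ i j : L, i ≠ j → Disjoint (Ω i) (Ω j))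
    (S₀ F₀ : Set (Fin n → ℝ))
    (Λ : L → Set (Fin n → ℝ))
    (hΛ : ∀ i : L, Λ i = (⋃ j ≥ i, Ω j) \ F₀)
    (τ : L → ℝ) (hτ : ∀ i : L, 0 < τ i)
    (x : ℝ → (Fin n → ℝ))
    (hinv : ∀ i : L, ∀ s t : ℝ, 0 ≤ s → s ≤ t → x s ∈ Λ i → x t ∈ Λ i)
    (hesc : ∀ i : L, ∀ t : ℝ, 0 ≤ t → x t ∈ Ω i \ S₀ → x (t + τ i) ∉ Ω i \ S₀)
    (i₀ : L) (h₀ : x 0 ∈ Λ i₀) :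
    (∃ r : ℕ, ∃ j : Fin (r + 1) → L, StrictMono j ∧ j 0 = i₀ ∧
      r + 1 ≤ Fintype.card L ∧
      ∃ t : ℝ, 0 ≤ t ∧ t ≤ ∑ k, τ (j k) ∧ x t ∈ S₀) ∧
    ∃ t : ℝ, 0 ≤ t ∧ t ≤ (∑ j ∈ Finset.univ.filter (fun j : L => i₀ ≤ j), τ j) ∧
      x t ∈ S₀ := by
  have key : ∀ i : L, ∀ s : ℝ, 0 ≤ s → x s ∈ Λ i →
      ∃ r : ℕ, ∃ j : Fin (r + 1) → L, StrictMono j ∧ j 0 = i ∧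
        ∃ t : ℝ, s ≤ t ∧ t ≤ s + ∑ k, τ (j k) ∧ x t ∈ S₀ := by
    intro i
    induction i using (wellFounded_gt (α := L)).induction with
    | _ i ih =>
    intro s hs hx
    have single : ∀ t : ℝ, s ≤ t → t ≤ s + τ i → x t ∈ S₀ →
        ∃ r : ℕ, ∃ j : Fin (r + 1) → L, StrictMono j ∧ j 0 = i ∧
        ∃ t : ℝ, s ≤ t ∧ t ≤ s + ∑ k, τ (j k) ∧ x t ∈ S₀ := by
      intro t h1 h2 h3
      exact ⟨0, fun _ => i, fun a b h => absurd h (by have := a.2; have := b.2; rw [Fin.lt_def]; omega), rfl, t, h1, by simpa using h2, h3⟩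
    have step : ∀ k : L, i < k → ∀ t : ℝ, s ≤ t → t ≤ s + τ i → x t ∈ Λ k →
        ∃ r : ℕ, ∃ j : Fin (r + 1) → L, StrictMono j ∧ j 0 = i ∧
        ∃ t : ℝ, s ≤ t ∧ t ≤ s + ∑ k, τ (j k) ∧ x t ∈ S₀ := by
      intro k hk t h1 h2 h3
      obtain ⟨r, j, hj, hj0, u, hu1, hu2, hu3⟩ := ih k hk t (hs.trans h1) h3
      refine ⟨r + 1, Matrix.vecCons i j, hj.vecCons (by rw [hj0]; exact hk), rfl,
        u, h1.trans hu1, ?_, hu3⟩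
      rw [Fin.sum_univ_succ]
      simp only [Matrix.cons_val_zero, Matrix.cons_val_succ]
      linarith
    have mem : ∀ t : ℝ, x t ∈ Λ i → ∃ k, i ≤ k ∧ x t ∈ Ω k ∧ x t ∈ Λ k := by
      intro t ht
      rw [hΛ] at ht
      obtain ⟨h1, h2⟩ := ht
      simp only [Set.mem_iUnion] at h1
      obtain ⟨k, hk, h1⟩ := h1
      refine ⟨k, hk, h1, ?_⟩
      rw [hΛ]
      refine ⟨?_, h2⟩
      simp only [Set.mem_iUnion]
      exact ⟨k, le_refl k, h1⟩
    have hτi := hτ i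
    by_cases hS : x s ∈ S₀
    · exact single s le_rfl (by linarith) hS
    obtain ⟨k, hk, hkΩ, hkΛ⟩ := mem s hx
    rcases hk.lt_or_eq with hlt | rfl
    · exact step k hlt s le_rfl (by linarith) hkΛ
    have hne := hesc i s hs ⟨hkΩ, hS⟩
    by_cases hS' : x (s + τ i) ∈ S₀
    · exact single _ (by linarith) le_rfl hS'
    obtain ⟨m, hm, hmΩ, hmΛ⟩ := mem (s + τ i) (hinv i s _ hs (by linarith) hx)
    rcases hm.lt_or_eq with hlt | rfl
    · exact step m hlt _ (by linarith) le_rfl hmΛ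
    · exact absurd ⟨hmΩ, hS'⟩ hne
  obtain ⟨r, j, hj, hj0, t, h1, h2, h3⟩ := key i₀ 0 le_rfl h₀
  rw [zero_add] at h2
  refine ⟨⟨r, j, hj, hj0, ?_, t, h1, h2, h3⟩, t, h1, h2.trans ?_, h3⟩
  · simpa using Fintype.card_le_of_injective j hj.injective
  · rw [← Finset.sum_image (s := Finset.univ) (g := j) (f := τ) hj.injective.injOn]
    apply Finset.sum_le_sum_of_subset_of_nonneg
    · intro a ha
      simp only [Finset.mem_image, Finset.mem_univ, true_and] at ha
      obtain ⟨k, rfl⟩ := ha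
      simp only [Finset.mem_filter, Finset.mem_univ, true_and]
      rw [← hj0]
      exact hj.monotone (Fin.zero_le k)
    · intro a _ _
      exact (hτ a).le
end
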